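/- arXiv:2203.16234 — 5 statements merged into one kernel-verified Lean document; each statement's English description precedes it below -/
import Mathlib

section
/- Let R be a complete regular local ring of Krull dimension 2 with regular system of parameters α, β, in which 2 is a unit, and let K be the fraction field of R. Let q(x₁, …, xₙ) = c₁x₁² + ⋯ + cₙxₙ² be a diagonal quadratic form over K in which every coefficient cᵢ is of one of the forms u, uα, uβ, or uαβ for some unit u of R. If q has a nontrivial zero over K_α (the fraction field of the completion of the discrete valuation ring R_(α)), then q has a nontrivial zero over K. -/
/-- The fraction field `K_P` of the adic completion of the localization of `R`
at a prime ideal `P`. -/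
noncomputable def CompletedLocalizationFractionField (R : Type) [CommRing R]
    (P : Ideal R) [P.IsPrime] : Type :=
  FractionRing (AdicCompletion
    (IsLocalRing.maximalIdeal (Localization.AtPrime P))
    (Localization.AtPrime P))

noncomputable instance (R : Type) [CommRing R] (P : Ideal R) [P.IsPrime] :
    CommRing (CompletedLocalizationFractionField R P) :=
  inferInstanceAs (CommRing (FractionRing (AdicCompletion
    (IsLocalRing.maximalIdeal (Localization.AtPrime P))
    (Localization.AtPrime P))))

/-- The canonical ring homomorphism `R → K_P`. -/
noncomputable def toCompletedLocalizationFractionField (R : Type) [CommRing R]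
    (P : Ideal R) [P.IsPrime] :
    R →+* CompletedLocalizationFractionField R P :=
  ((algebraMap
      (AdicCompletion (IsLocalRing.maximalIdeal (Localization.AtPrime P))
        (Localization.AtPrime P))
      (FractionRing (AdicCompletion
        (IsLocalRing.maximalIdeal (Localization.AtPrime P))
        (Localization.AtPrime P)))).comp
    ((algebraMap (Localization.AtPrime P)
        (AdicCompletion (IsLocalRing.maximalIdeal (Localization.AtPrime P))
          (Localization.AtPrime P))).comp
      (algebraMap R (Localization.AtPrime P))))

open IsLocalRing in
/-- The maximal ideal of a noetherian local ring of dimension two is not principal. -/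
theorem maximalIdeal_ne_span_singleton_of_ringKrullDim_eq_two {R : Type*} [CommRing R]
    [IsNoetherianRing R] [IsLocalRing R] (hdim : ringKrullDim R = 2) (x : R) :
    maximalIdeal R ≠ Ideal.span {x} := by
  intro h
  have hx : ¬ IsUnit x := by
    rw [← mem_nonunits_iff, ← mem_maximalIdeal, h]
    exact Ideal.mem_span_singleton_self x
  have h1 := Ideal.height_span_singleton_le_one hx
  rw [← h] at h1
  have h2 := maximalIdeal_height_eq_ringKrullDim (R := R)
  rw [hdim] at h2
  have h3 : (maximalIdeal R).height = 2 := WithBot.coe_injective h2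
  rw [h3] at h1
  exact absurd h1 (by decide)

open IsLocalRing in
/-- In a two-dimensional noetherian local ring with `m = (x, y)`, the ideal `(x)` is prime. -/
theorem isPrime_span_singleton_of_maximalIdeal_eq_span_pair {R : Type*} [CommRing R]
    [IsNoetherianRing R] [IsLocalRing R] (hdim : ringKrullDim R = 2) {x y : R}
    (hm : maximalIdeal R = Ideal.span {x, y}) : (Ideal.span {x}).IsPrime := by
  have hx : x ∈ maximalIdeal R := hm ▸ Ideal.subset_span (by simp)
  have hy : y ∈ maximalIdeal R := hm ▸ Ideal.subset_span (by simp)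
  have hne : Ideal.span {x} ≠ ⊤ := by
    rw [Ne, Ideal.span_singleton_eq_top]
    exact hx
  obtain ⟨p, hp⟩ := Ideal.nonempty_minimalPrimes hne
  have hpp : p.IsPrime := hp.1.1
  have hxp : x ∈ p := hp.1.2 (Ideal.mem_span_singleton_self x)
  have hyp : y ∉ p := by
    intro hyp
    have hpm : p = maximalIdeal R := by
      refine le_antisymm (le_maximalIdeal hpp.ne_top) ?_
      rw [hm, Ideal.span_le]
      rintro z (rfl | rfl)
      exacts [hxp, hyp]
    have h1 := Ideal.height_le_one_of_isPrincipal_of_mem_minimalPrimes _ p hp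
    have h2 := maximalIdeal_height_eq_ringKrullDim (R := R)
    rw [hdim] at h2
    have h3 : (maximalIdeal R).height = 2 := WithBot.coe_injective h2
    rw [hpm, h3] at h1
    exact absurd h1 (by decide)
  have hle : p ≤ Ideal.span {x} ⊔ maximalIdeal R • p := by
    intro z hz
    have hzm : z ∈ Ideal.span {x, y} := hm ▸ le_maximalIdeal hpp.ne_top hz
    obtain ⟨a, b, rfl⟩ := Ideal.mem_span_pair.1 hzm
    have hby : b * y ∈ p := (Ideal.add_mem_iff_right p (p.mul_mem_left a hxp)).1 hz
    have hb : b ∈ p := (hpp.mem_or_mem hby).resolve_right hyp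
    refine Submodule.add_mem_sup (Ideal.mul_mem_left _ _ (Ideal.mem_span_singleton_self x)) ?_
    rw [mul_comm]
    exact Submodule.smul_mem_smul hy hb
  have : p ≤ Ideal.span {x} :=
    Submodule.le_of_le_smul_of_le_jacobson_bot (IsNoetherian.noetherian p)
      (maximalIdeal_le_jacobson ⊥) hle
  rwa [← le_antisymm this hp.1.2]

open IsLocalRing in
/-- A two-dimensional regular local ring is a domain. -/
theorem isDomain_of_ringKrullDim_eq_two_of_maximalIdeal_eq_span_pair {R : Type*} [CommRing R]
    [IsNoetherianRing R] [IsLocalRing R] (hdim : ringKrullDim R = 2) {α β : R}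
    (hm : maximalIdeal R = Ideal.span {α, β}) : IsDomain R := by
  have hα : α ∈ maximalIdeal R := hm ▸ Ideal.subset_span (by simp)
  have hβ : β ∈ maximalIdeal R := hm ▸ Ideal.subset_span (by simp)
  obtain ⟨j, hj⟩ : ∃ j : ℕ, ∀ p ∈ minimalPrimes R, α + β ^ (j + 1) ∉ p := by
    by_contra! hcon
    choose p hp hxp using hcon
    have := (minimalPrimes.finite_of_isNoetherianRing R).to_subtype
    obtain ⟨i, j, hij, hpij⟩ := Finite.exists_ne_map_eq_of_infinite
      (fun j => (⟨p j, hp j⟩ : minimalPrimes R))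
    wlog hlt : i < j generalizing i j
    · exact this j i hij.symm hpij.symm (by omega)
    have hpp : (p i).IsPrime := (hp i).1.1
    have hpe : p i = p j := congrArg Subtype.val hpij
    have h1 : β ^ (i + 1) * (1 - β ^ (j - i)) ∈ p i := by
      have h := (p i).sub_mem (hxp i) (hpe ▸ hxp j)
      have he : β ^ (j + 1) = β ^ (i + 1) * β ^ (j - i) := by
        rw [← pow_add]; congr 1; omega
      rw [he] at h
      convert h using 1
      ring
    have hu : IsUnit (1 - β ^ (j - i)) :=
      isUnit_one_sub_self_of_mem_nonunits _
        ((mem_maximalIdeal _).1 (Ideal.pow_mem_of_mem _ hβ _ (by omega)))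
    have hβp : β ∈ p i := hpp.mem_of_pow_mem _ ((hpp.mem_or_mem h1).resolve_right
      fun h => hpp.ne_top (Ideal.eq_top_of_isUnit_mem _ h hu))
    have hαp : α ∈ p i := ((p i).add_mem_iff_left
      (Ideal.pow_mem_of_mem _ hβp _ (by omega))).1 (hxp i)
    have hpm : p i = maximalIdeal R := by
      refine le_antisymm (le_maximalIdeal hpp.ne_top) ?_
      rw [hm, Ideal.span_le]
      rintro z (rfl | rfl)
      exacts [hαp, hβp]
    have h2 := maximalIdeal_height_eq_ringKrullDim (R := R)
    have h3 : (maximalIdeal R).height = 0 := by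
      rw [← hpm]
      exact Ideal.height_eq_zero_iff.2 (hp i)
    rw [hdim, h3] at h2
    exact absurd h2 (by decide)
  set x := α + β ^ (j + 1) with hx
  have hmx : maximalIdeal R = Ideal.span {x, β} := by
    have hβ' : β ∈ Ideal.span {x, β} := Ideal.subset_span (by simp)
    have hx' : x ∈ Ideal.span {x, β} := Ideal.subset_span (by simp)
    apply le_antisymm
    · rw [hm, Ideal.span_le]
      rintro z (rfl | rfl)
      · exact (Ideal.add_mem_iff_left _ (Ideal.pow_mem_of_mem _ hβ' _ (by omega))).1 hx'
      · exact hβ'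
    · rw [Ideal.span_le]
      rintro z (rfl | rfl)
      · exact Ideal.add_mem _ hα (Ideal.pow_mem_of_mem _ hβ _ (by omega))
      · exact hβ
  have hxm : x ∈ maximalIdeal R := hmx ▸ Ideal.subset_span (by simp)
  have hprime := isPrime_span_singleton_of_maximalIdeal_eq_span_pair hdim hmx
  obtain ⟨p, hp, hpx⟩ := Ideal.exists_minimalPrimes_le (bot_le : ⊥ ≤ Ideal.span {x})
  have hpp : p.IsPrime := hp.1.1
  have hle : p ≤ ⊥ ⊔ maximalIdeal R • p := by
    intro z hz
    obtain ⟨a, rfl⟩ := Ideal.mem_span_singleton.1 (hpx hz)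
    rw [bot_sup_eq]
    exact Submodule.smul_mem_smul hxm ((hpp.mem_or_mem hz).resolve_left (hj p hp))
  have hbot : p = ⊥ := le_bot_iff.1 <|
    Submodule.le_of_le_smul_of_le_jacobson_bot (IsNoetherian.noetherian p)
      (maximalIdeal_le_jacobson ⊥) hle
  rw [hbot] at hpp
  exact IsDomain.of_bot_isPrime R

/-- Descent of a diagonal form along a prime `π` whose square does not divide the coefficients:
an approximate zero of `∑ wᵢ π^(sᵢ) xᵢ²` yields a primitive zero modulo `π` of one of the two
forms obtained by fixing `sᵢ`. -/
theorem exists_primitive_zero_mod_prime {B ι : Type*} [CommRing B] [IsDomain B] {π : B}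
    (hπ : Prime π) (S : Finset ι) (w : ι → B) (s : ι → ℕ) (hs : ∀ i, s i = 0 ∨ s i = 1)
    (N : ℕ) (b : ι → B) (h : π ^ (2 * N) ∣ ∑ i ∈ S, w i * π ^ s i * b i ^ 2)
    (hb : ∃ i ∈ S, ¬ π ^ N ∣ b i) :
    ∃ (e : ℕ) (b' : ι → B), π ∣ ∑ i ∈ S with s i = e, w i * b' i ^ 2 ∧
      ∃ i ∈ S, s i = e ∧ ¬ π ∣ b' i := by
  induction N generalizing b with
  | zero => simp at hb
  | succ N ih =>
    by_cases hall : ∀ i ∈ S, π ∣ b i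
    · have hex : ∀ i, ∃ d, i ∈ S → b i = π * d := fun i => by
        by_cases hi : i ∈ S
        · obtain ⟨d, hd⟩ := hall i hi
          exact ⟨d, fun _ => hd⟩
        · exact ⟨0, fun h => absurd h hi⟩
      choose d hd using hex
      refine ih d ?_ ?_
      · have hsum : ∑ i ∈ S, w i * π ^ s i * b i ^ 2 =
            π ^ 2 * ∑ i ∈ S, w i * π ^ s i * d i ^ 2 := by
          rw [Finset.mul_sum]
          refine Finset.sum_congr rfl fun i hi => ?_
          rw [hd i hi]
          ring
        rw [hsum, mul_add, mul_one, add_comm, pow_add] at h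
        exact (mul_dvd_mul_iff_left (pow_ne_zero 2 hπ.ne_zero)).1 h
      · obtain ⟨i, hi, hbi⟩ := hb
        refine ⟨i, hi, fun hdi => hbi ?_⟩
        rw [hd i hi, pow_succ']
        exact mul_dvd_mul_left _ hdi
    · push Not at hall
      have h2 : π ^ 2 ∣ ∑ i ∈ S, w i * π ^ s i * b i ^ 2 :=
        (pow_dvd_pow π (by omega)).trans h
      have hsplit : ∑ i ∈ S, w i * π ^ s i * b i ^ 2 =
          ∑ i ∈ S with s i = 0, w i * b i ^ 2 + π * ∑ i ∈ S with s i = 1, w i * b i ^ 2 := by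
        rw [Finset.mul_sum, Finset.sum_filter, Finset.sum_filter, ← Finset.sum_add_distrib]
        refine Finset.sum_congr rfl fun i _ => ?_
        rcases hs i with hi | hi
        · simp [hi]
        · simp [hi]
          ring
      rw [hsplit] at h2
      by_cases h0 : ∃ i ∈ S, s i = 0 ∧ ¬ π ∣ b i
      · refine ⟨0, b, ?_, h0⟩
        exact (dvd_add_left (dvd_mul_right _ _)).1 ((dvd_pow_self π two_ne_zero).trans h2)
      · push Not at h0
        refine ⟨1, b, ?_, ?_⟩
        · have h3 : π ^ 2 ∣ ∑ i ∈ S with s i = 0, w i * b i ^ 2 :=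
            Finset.dvd_sum fun i hi => by
              obtain ⟨hiS, hi0⟩ := Finset.mem_filter.1 hi
              exact (pow_dvd_pow_of_dvd (h0 i hiS hi0) 2).mul_left _
          have h4 := (dvd_add_right h3).1 h2
          rw [sq] at h4
          exact (mul_dvd_mul_iff_left hπ.ne_zero).1 h4
        · obtain ⟨i, hi, hbi⟩ := hall
          exact ⟨i, hi, (hs i).resolve_left fun h => hbi (h0 i hi h), hbi⟩

/-- Hensel lifting for diagonal quadratic forms with unit coefficients. -/
theorem exists_isUnit_zero_of_zero_mod_maximalIdeal {R ι : Type*} [CommRing R]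
    [IsLocalRing R] [HenselianRing R (IsLocalRing.maximalIdeal R)]
    (h2 : IsUnit (2 : R)) (T : Finset ι) (u : ι → Rˣ) (b : ι → R)
    (h : ∑ i ∈ T, (u i : R) * b i ^ 2 ∈ IsLocalRing.maximalIdeal R)
    (hb : ∃ i ∈ T, IsUnit (b i)) :
    ∃ y : ι → R, ∑ i ∈ T, (u i : R) * y i ^ 2 = 0 ∧ ∃ i ∈ T, IsUnit (y i) := by
  classical
  obtain ⟨k, hk, hbk⟩ := hb
  set r := ∑ i ∈ T.erase k, (u i : R) * b i ^ 2 with hr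
  rw [← Finset.add_sum_erase T _ hk, ← hr] at h
  obtain ⟨a, ha, hab⟩ := HenselianRing.is_henselian (I := IsLocalRing.maximalIdeal R)
    (Polynomial.X ^ 2 + Polynomial.C (((u k)⁻¹ : Rˣ) * r))
    (Polynomial.monic_X_pow_add_C _ two_ne_zero) (b k)
    (by
      have := Ideal.mul_mem_left _ (((u k)⁻¹ : Rˣ) : R) h
      rw [mul_add, Units.inv_mul_cancel_left] at this
      simpa using this)
    (by
      apply IsUnit.map
      simpa [one_add_one_eq_two] using h2.mul hbk)
  have ha' : a ^ 2 + ((u k)⁻¹ : Rˣ) * r = 0 := by simpa using ha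
  refine ⟨Function.update b k a, ?_, k, hk, ?_⟩
  · rw [← Finset.add_sum_erase T _ hk]
    have hsum : ∑ i ∈ T.erase k, (u i : R) * Function.update b k a i ^ 2 = r :=
      Finset.sum_congr rfl fun i hi => by
        rw [Function.update_of_ne (Finset.ne_of_mem_erase hi)]
    rw [hsum, Function.update_self]
    linear_combination (u k : R) * ha' - r * (u k).mul_inv
  · rw [Function.update_self]
    by_contra hna
    have : b k ∈ IsLocalRing.maximalIdeal R := by
      have := Ideal.sub_mem _ ((IsLocalRing.mem_maximalIdeal a).2 hna) hab
      simpa using this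
    exact (IsLocalRing.mem_maximalIdeal _).1 this hbk

/-- A power of a prime element divides an element as soon as it does so after localizing at the
prime ideal it generates. -/
theorem pow_dvd_of_algebraMap_mem_maximalIdeal_pow {R : Type*} [CommRing R] [IsDomain R]
    {α : R} [hP : (Ideal.span {α}).IsPrime] (hα : Prime α) {N : ℕ} {r : R}
    (h : algebraMap R (Localization.AtPrime (Ideal.span {α})) r ∈
      IsLocalRing.maximalIdeal (Localization.AtPrime (Ideal.span {α})) ^ N) : α ^ N ∣ r := by
  rw [← Localization.AtPrime.map_eq_maximalIdeal, ← Ideal.map_pow,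
    IsLocalization.algebraMap_mem_map_algebraMap_iff (Ideal.span {α}).primeCompl] at h
  obtain ⟨m, hm, hmr⟩ := h
  rw [Ideal.span_singleton_pow, Ideal.mem_span_singleton] at hmr
  refine hα.pow_dvd_of_dvd_mul_left _ (fun hd => hm ?_) hmr
  exact Ideal.mem_span_singleton.2 hd

/-- Clearing denominators in a zero of a diagonal quadratic form. -/
theorem exists_zero_of_zero_over_fractionRing {C ι : Type*} [CommRing C] [Fintype ι] (c : ι → C)
    (h : ∃ x : ι → FractionRing C, x ≠ 0 ∧
      ∑ i, algebraMap C (FractionRing C) (c i) * x i ^ 2 = 0) :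
    ∃ a : ι → C, a ≠ 0 ∧ ∑ i, c i * a i ^ 2 = 0 := by
  obtain ⟨x, hx, hsum⟩ := h
  obtain ⟨s, hs⟩ := IsLocalization.exist_integer_multiples_of_finite (nonZeroDivisors C) x
  choose a ha using hs
  simp only [Algebra.smul_def] at ha
  refine ⟨a, fun h0 => hx (funext fun i => ?_), ?_⟩
  · have h1 := ha i
    rw [h0, Pi.zero_apply, map_zero] at h1
    exact ((IsLocalization.map_units (FractionRing C) s).mul_right_eq_zero).1 h1.symm
  · apply IsFractionRing.injective C (FractionRing C)
    rw [map_sum, map_zero, ← mul_zero (algebraMap C (FractionRing C) s ^ 2), ← hsum,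
      Finset.mul_sum]
    refine Finset.sum_congr rfl fun i _ => ?_
    rw [map_mul, map_pow, ha]
    ring

/-- A zero of a diagonal form over `K_α` yields approximate zeros over `R`. -/
theorem exists_approximate_zero_of_zero_over_completed_localization (R : Type) [CommRing R]
    [IsDomain R] (α : R) [hP : (Ideal.span {α} : Ideal R).IsPrime] (hα : Prime α)
    {ι : Type*} [Fintype ι] (c : ι → R)
    (hzero : ∃ x : ι → CompletedLocalizationFractionField R (Ideal.span {α}),
      x ≠ 0 ∧ ∑ i, toCompletedLocalizationFractionField R (Ideal.span {α}) (c i)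
        * x i ^ 2 = 0) :
    ∃ (N : ℕ) (b : ι → R), α ^ (2 * N) ∣ ∑ i, c i * b i ^ 2 ∧ ∃ i, ¬ α ^ N ∣ b i := by
  let A := Localization.AtPrime (Ideal.span {α})
  let I := IsLocalRing.maximalIdeal A
  let C := AdicCompletion I A
  obtain ⟨a, ha, hasum⟩ : ∃ a : ι → C, a ≠ 0 ∧
      ∑ i, algebraMap A C (algebraMap R A (c i)) * a i ^ 2 = 0 :=
    exists_zero_of_zero_over_fractionRing _ hzero
  obtain ⟨i₀, N, hN⟩ : ∃ i N, AdicCompletion.evalₐ I N (a i) ≠ 0 := by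
    by_contra! h
    exact ha (funext fun i => AdicCompletion.ext_evalₐ fun N => by
      rw [h i N, Pi.zero_apply, map_zero])
  choose f hf using fun i => AdicCompletion.mk_surjective I A (a i)
  let d : ι → A := fun i => f i (2 * N)
  have hd : ∀ i, Ideal.Quotient.mk (I ^ (2 * N)) (d i) = AdicCompletion.evalₐ I (2 * N) (a i) :=
    fun i => by rw [← hf, AdicCompletion.evalₐ_mk]
  have hdsum : ∑ i, algebraMap R A (c i) * d i ^ 2 ∈ I ^ (2 * N) := by
    rw [← Ideal.Quotient.eq_zero_iff_mem, map_sum]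
    have := congrArg (AdicCompletion.evalₐ I (2 * N)) hasum
    rw [map_sum, map_zero] at this
    rw [← this]
    refine Finset.sum_congr rfl fun i _ => ?_
    rw [map_mul, map_pow, map_mul, map_pow, hd]
    rfl
  have hdN : d i₀ ∉ I ^ N := by
    rw [← Ideal.Quotient.eq_zero_iff_mem]
    intro h0
    apply hN
    rw [← hf, AdicCompletion.evalₐ_mk, ← h0]
    exact (AdicCompletion.Ideal.mk_eq_mk I (by omega : N ≤ 2 * N) (f i₀)).symm
  obtain ⟨s, hs⟩ := IsLocalization.exist_integer_multiples_of_finite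
    (Ideal.span {α}).primeCompl d
  choose b hb using hs
  simp only [Algebra.smul_def] at hb
  refine ⟨N, b, ?_, i₀, ?_⟩
  · apply pow_dvd_of_algebraMap_mem_maximalIdeal_pow hα
    have := Ideal.mul_mem_left _ (algebraMap R A s ^ 2) hdsum
    convert this using 1
    rw [map_sum, Finset.mul_sum]
    refine Finset.sum_congr rfl fun i _ => ?_
    rw [map_mul, map_pow, hb]
    ring
  · rintro ⟨t, ht⟩
    apply hdN
    have hu : IsUnit (algebraMap R A s) := IsLocalization.map_units A s
    rw [← Ideal.unit_mul_mem_iff_mem _ hu, ← hb, ht, map_mul, map_pow]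
    refine Ideal.mul_mem_right _ _ (Ideal.pow_mem_pow ?_ N)
    change algebraMap R A α ∈ IsLocalRing.maximalIdeal (Localization.AtPrime (Ideal.span {α}))
    rw [← Localization.AtPrime.map_eq_maximalIdeal]
    exact Ideal.mem_map_of_mem _ (Ideal.mem_span_singleton_self α)

/-- Let `R` be a complete regular local ring of Krull
dimension 2 with regular system of parameters `α, β`, in which `2` is a unit,
and let `K` be the fraction field of `R`.  Let
`q(x₁, …, xₙ) = c₁x₁² + ⋯ + cₙxₙ²` be a diagonal quadratic form over `K` whose
coefficients are each of the form `u`, `uα`, `uβ` or `uαβ` with `u ∈ Rˣ`.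
If `q` has a nontrivial zero over `K_α` (the fraction field of the completion
of the discrete valuation ring `R_(α)`), then `q` has a nontrivial zero over
`K`. -/
theorem isotropic_of_isotropic_over_completed_localization
    (R : Type) [CommRing R] [IsNoetherianRing R] [IsLocalRing R]
    (hcompl : IsAdicComplete (IsLocalRing.maximalIdeal R) R)
    (α β : R)
    (hparams : IsLocalRing.maximalIdeal R = Ideal.span {α, β})
    (hdim : ringKrullDim R = 2)
    (h2 : IsUnit (2 : R))
    [hP : (Ideal.span {α} : Ideal R).IsPrime]
    (n : ℕ) (c : Fin n → R)
    (hshape : ∀ i, ∃ u : Rˣ,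
      c i = u ∨ c i = u * α ∨ c i = u * β ∨ c i = u * α * β)
    (hzero : ∃ x : Fin n → CompletedLocalizationFractionField R (Ideal.span {α}),
      x ≠ 0 ∧ ∑ i, toCompletedLocalizationFractionField R (Ideal.span {α}) (c i)
        * x i ^ 2 = 0) :
    ∃ x : Fin n → FractionRing R, x ≠ 0 ∧
      ∑ i, algebraMap R (FractionRing R) (c i) * x i ^ 2 = 0 := by
  have hdom := isDomain_of_ringKrullDim_eq_two_of_maximalIdeal_eq_span_pair hdim hparams
  have hα : Prime α := by
    rw [← Ideal.span_singleton_prime]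
    · exact hP
    · rintro rfl
      refine maximalIdeal_ne_span_singleton_of_ringKrullDim_eq_two hdim β ?_
      rw [hparams, Ideal.span_insert_zero]
  have hform : ∀ i, ∃ (u : Rˣ) (s t : ℕ), (s = 0 ∨ s = 1) ∧ (t = 0 ∨ t = 1) ∧
      c i = u * β ^ t * α ^ s := fun i => by
    obtain ⟨u, h | h | h | h⟩ := hshape i
    · exact ⟨u, 0, 0, by simp, by simp, by rw [h]; ring⟩
    · exact ⟨u, 1, 0, by simp, by simp, by rw [h]; ring⟩
    · exact ⟨u, 0, 1, by simp, by simp, by rw [h]; ring⟩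
    · exact ⟨u, 1, 1, by simp, by simp, by rw [h]; ring⟩
  choose u s t hs ht hc using hform
  obtain ⟨N, b, hbsum, i, hbi⟩ :=
    exists_approximate_zero_of_zero_over_completed_localization R α hα c hzero
  simp only [hc] at hbsum
  obtain ⟨e, b, hbsum, i, -, hie, hbi⟩ := exists_primitive_zero_mod_prime hα Finset.univ
    (fun i => u i * β ^ t i) s hs N b hbsum ⟨i, Finset.mem_univ i, hbi⟩
  let B := R ⧸ Ideal.span {α}
  let φ : R →+* B := Ideal.Quotient.mk (Ideal.span {α})
  have hφ : ∀ r, φ β ∣ φ r ↔ r ∈ IsLocalRing.maximalIdeal R := fun r => by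
    rw [hparams, Set.pair_comm, Ideal.mem_span_pair]
    constructor
    · rintro ⟨q, hq⟩
      obtain ⟨q, rfl⟩ := Ideal.Quotient.mk_surjective q
      rw [← map_mul, Ideal.Quotient.eq, Ideal.mem_span_singleton'] at hq
      obtain ⟨a, ha⟩ := hq
      exact ⟨q, a, by linear_combination ha⟩
    · rintro ⟨q, a, rfl⟩
      refine ⟨φ q, ?_⟩
      have h0 : φ α = 0 :=
        Ideal.Quotient.eq_zero_iff_mem.2 (Ideal.mem_span_singleton_self α)
      rw [map_add, map_mul, map_mul, h0]
      ring
  have hβ : Prime (φ β) := by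
    refine ⟨fun h0 => ?_, fun hu => ?_, fun x y => ?_⟩
    · refine maximalIdeal_ne_span_singleton_of_ringKrullDim_eq_two hdim α ?_
      rw [hparams, Ideal.span_insert, sup_eq_left, Ideal.span_singleton_le_iff_mem]
      exact Ideal.Quotient.eq_zero_iff_mem.1 h0
    · have h1 : φ β ∣ φ 1 := by rw [map_one]; exact isUnit_iff_dvd_one.1 hu
      exact (IsLocalRing.mem_maximalIdeal _).1 ((hφ 1).1 h1) isUnit_one
    · obtain ⟨x, rfl⟩ := Ideal.Quotient.mk_surjective x
      obtain ⟨y, rfl⟩ := Ideal.Quotient.mk_surjective y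
      change φ β ∣ φ x * φ y → φ β ∣ φ x ∨ φ β ∣ φ y
      rw [← map_mul, hφ, hφ, hφ]
      exact Ideal.IsPrime.mem_or_mem inferInstance
  have hbφ : φ (b i) ≠ 0 := fun h0 =>
    hbi (Ideal.mem_span_singleton.1 (Ideal.Quotient.eq_zero_iff_mem.1 h0))
  obtain ⟨N, hN⟩ := FiniteMultiplicity.of_not_isUnit hβ.not_isUnit hbφ
  have hbsum' : φ β ^ (2 * (N + 1)) ∣
      ∑ i with s i = e, φ (u i) * φ β ^ t i * φ (b i) ^ 2 := by
    have h0 : φ (∑ i with s i = e, u i * β ^ t i * b i ^ 2) = 0 :=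
      Ideal.Quotient.eq_zero_iff_mem.2 (Ideal.mem_span_singleton.2 hbsum)
    simp only [map_sum, map_mul, map_pow] at h0
    rw [h0]
    exact dvd_zero _
  obtain ⟨f, d, hdsum, j, hje, hjf, hdj⟩ := exists_primitive_zero_mod_prime hβ _ _ t ht (N + 1) _
    hbsum' ⟨i, by simpa using hie, hN⟩
  choose d' hd' using fun i => Ideal.Quotient.mk_surjective (d i)
  obtain rfl : (fun i => φ (d' i)) = d := funext hd'
  rw [Finset.filter_filter] at hdsum
  simp only [← map_pow, ← map_mul, ← map_sum] at hdsum
  rw [hφ] at hdsum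
  rw [hφ] at hdj
  have hje' : s j = e := by simpa using hje
  obtain ⟨y, hy, k, hk, hyk⟩ := exists_isUnit_zero_of_zero_mod_maximalIdeal h2
    _ u d' hdsum ⟨j, by simp [hje', hjf], by simpa using hdj⟩
  refine ⟨fun i => if s i = e ∧ t i = f then algebraMap R _ (y i) else 0, fun h0 => ?_, ?_⟩
  · have h1 := congrFun h0 k
    rw [Finset.mem_filter] at hk
    simp only [hk.2, and_self, if_true, Pi.zero_apply] at h1
    exact (hyk.map (algebraMap R (FractionRing R))).ne_zero h1
  · have h0 : algebraMap R (FractionRing R)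
        (β ^ f * α ^ e * ∑ i with s i = e ∧ t i = f, u i * y i ^ 2) = 0 := by
      rw [hy, mul_zero, map_zero]
    refine Eq.trans ?_ h0
    rw [Finset.mul_sum, map_sum, Finset.sum_filter]
    refine Finset.sum_congr rfl fun i _ => ?_
    dsimp only
    split_ifs with hi
    · rw [hc, hi.1, hi.2, ← map_pow, ← map_mul]
      congr 1
      ring
    · simp
end

section
/- Let k be a field that is complete with respect to a nontrivial nonarchimedean multiplicative absolute value. For every positive integer m and all real numbers 0 < a < b, there exists a finite field extension l of k such that the degree [l : k] is coprime to m and l contains an element w with a < |w| < b, where |·| denotes the unique absolute value on l extending that of k. Moreover, if the value group |k^×| is dense in the positive reals, one may take l = k. -/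
open scoped NNReal

/-- `v` is a nontrivial (nonarchimedean multiplicative) absolute value:
some nonzero element has value different from `1`. -/
def Valuation.IsNontrivialVal {k : Type} [Field k] (v : Valuation k ℝ≥0) : Prop :=
  ∃ x : k, x ≠ 0 ∧ v x ≠ 1

open Polynomial IntermediateField in
/-- A prime-order root of a field element can be found in degree one or in that prime degree. -/
theorem exists_pow_eq_and_finrank_adjoin {k L : Type*} [Field k] [Field L] [Algebra k L]
    [IsAlgClosed L] {p : ℕ} (hp : p.Prime) (c : k) :
    ∃ r : L, r ^ p = algebraMap k L c ∧
      (Module.finrank k k⟮r⟯ = 1 ∨ Module.finrank k k⟮r⟯ = p) := by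
  by_cases h : ∃ d : k, d ^ p = c
  · obtain ⟨d, rfl⟩ := h
    refine ⟨algebraMap k L d, by simp, Or.inl ?_⟩
    rw [IntermediateField.finrank_eq_one_iff, adjoin_simple_eq_bot_iff]
    exact IntermediateField.algebraMap_mem _ d
  · push Not at h
    obtain ⟨r, hr⟩ := IsAlgClosed.exists_pow_nat_eq (algebraMap k L c) hp.pos
    refine ⟨r, hr, Or.inr ?_⟩
    have hmonic : (X ^ p - C c : k[X]).Monic := monic_X_pow_sub_C c hp.ne_zero
    have hroot : aeval r (X ^ p - C c : k[X]) = 0 := by simp [hr]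
    rw [adjoin.finrank ⟨_, hmonic, hroot⟩,
      ← minpoly.eq_of_irreducible_of_monic (X_pow_sub_C_irreducible_of_prime hp h) hroot hmonic,
      natDegree_X_pow_sub_C]

/-- A nontrivial complete real-valued valuation extends to every algebraic extension. -/
theorem Valuation.exists_extension_of_completeSpace {k L : Type*} [Field k] [Field L] [Algebra k L]
    [Algebra.IsAlgebraic k L] (v : Valuation k ℝ≥0) (hnt : ∃ x : k, x ≠ 0 ∧ v x ≠ 1)
    (hcompl : letI : Valued k ℝ≥0 := Valued.mk' v; CompleteSpace k) :
    ∃ w : Valuation L ℝ≥0, ∀ x : k, w (algebraMap k L x) = v x := by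
  let : Valued k ℝ≥0 := Valued.mk' v
  let : v.RankOne :=
    { hom' := MonoidWithZeroHom.ValueGroup₀.embedding
      strictMono' := MonoidWithZeroHom.ValueGroup₀.embedding_strictMono
      exists_val_nontrivial := by
        obtain ⟨x, hx0, hx1⟩ := hnt
        exact ⟨x, v.ne_zero_iff.mpr hx0, hx1⟩ }
  let : (Valued.v (R := k) (Γ₀ := ℝ≥0)).RankOne := ‹v.RankOne›
  let : NontriviallyNormedField k := Valued.toNontriviallyNormedField k ℝ≥0
  have : IsUltrametricDist k := Valued.instIsUltrametricDist k ℝ≥0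
  have : CompleteSpace k := hcompl
  refine ⟨
    { toFun x := ⟨spectralNorm k L x, spectralNorm_nonneg x⟩
      map_zero' := NNReal.eq spectralNorm_zero
      map_one' := NNReal.eq spectralNorm_one
      map_mul' x y := NNReal.eq (spectralAlgNorm_mul x y)
      map_add_le_max' x y := isNonarchimedean_spectralNorm x y }, fun x ↦ NNReal.eq ?_⟩
  refine (spectralNorm_extends x).trans ?_
  exact congrArg NNReal.toReal (MonoidWithZeroHom.ValueGroup₀.embedding_restrict₀ x)

/-- An element close enough to `1` from above has an integer power in a given interval. -/
theorem exists_zpow_mem_Ioo {a b s : ℝ} (ha : 0 < a) (hs : 1 < s) (hsab : s < b / a) :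
    ∃ i : ℤ, s ^ i ∈ Set.Ioo a b := by
  obtain ⟨i, hi, hi'⟩ := exists_mem_Ico_zpow ha hs
  refine ⟨i + 1, hi', ?_⟩
  rw [zpow_add_one₀ (by positivity)]
  calc s ^ i * s ≤ a * s := by gcongr
    _ < b := by rwa [mul_comm, ← lt_div_iff₀ ha]

/-- Let `k` be a field complete with respect to a nontrivial
nonarchimedean multiplicative absolute value `v`.  For every positive integer
`m` and all reals `0 < a < b` there is a finite field extension `l / k` of
degree coprime to `m` containing an element `w` with `a < |w| < b`, where the
absolute value on `l` extends that of `k`.  Moreover, if the value group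
`|k^×|` is dense in the positive reals, one may take `l = k`. -/
theorem exists_coprime_degree_extension_with_element_of_prescribed_absolute_value
    (k : Type) [Field k] (v : Valuation k ℝ≥0)
    (hnt : v.IsNontrivialVal)
    (hcompl : letI : Valued k ℝ≥0 := Valued.mk' v; CompleteSpace k)
    (m : ℕ) (hm : 0 < m) (a b : ℝ) (ha : 0 < a) (hab : a < b) :
    (∃ l : IntermediateField k (AlgebraicClosure k),
      FiniteDimensional k l ∧
      Nat.Coprime (Module.finrank k l) m ∧
      ∃ vl : Valuation l ℝ≥0,
        (∀ x : k, vl (algebraMap k l x) = v x) ∧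
        ∃ w : l, a < (vl w : ℝ) ∧ (vl w : ℝ) < b) ∧
    ((∀ c d : ℝ, 0 < c → c < d → ∃ x : k, x ≠ 0 ∧ c < (v x : ℝ) ∧ (v x : ℝ) < d) →
      ∃ w : k, a < (v w : ℝ) ∧ (v w : ℝ) < b) := by
  refine ⟨?_, fun h ↦ (h a b ha hab).imp fun _ hx ↦ hx.2⟩
  obtain ⟨c, hc⟩ : ∃ c : k, 1 < v c := by
    obtain ⟨x, hx0, hx1⟩ := hnt
    rcases hx1.lt_or_gt with h | h
    · exact ⟨x⁻¹, by rw [map_inv₀]; exact (one_lt_inv₀ (v.pos_iff.mpr hx0)).mpr h⟩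
    · exact ⟨x, h⟩
  have hba : 1 < b / a := (one_lt_div ha).mpr hab
  obtain ⟨n, hn⟩ := pow_unbounded_of_one_lt (v c : ℝ) hba
  obtain ⟨p, hpn, hp⟩ := Nat.exists_infinite_primes (n + m + 1)
  obtain ⟨r, hr, hdeg⟩ := exists_pow_eq_and_finrank_adjoin (L := AlgebraicClosure k) hp c
  have hfin : 0 < Module.finrank k (IntermediateField.adjoin k {r}) := by
    rcases hdeg with h | h <;> rw [h]
    exacts [one_pos, hp.pos]
  obtain ⟨w, hw⟩ := v.exists_extension_of_completeSpace
    (L := IntermediateField.adjoin k {r}) hnt hcompl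
  refine ⟨_, Module.finite_of_finrank_pos hfin, ?_, w, hw, ?_⟩
  · rcases hdeg with h | h <;> rw [h]
    · exact Nat.coprime_one_left m
    · exact (Nat.Prime.coprime_iff_not_dvd hp).mpr fun hd ↦ by
        have := Nat.le_of_dvd hm hd
        lia
  set s := IntermediateField.AdjoinSimple.gen k r
  have hs : (w s : ℝ) ^ p = v c := by
    rw [← NNReal.coe_pow, ← map_pow, ← hw]
    congr 2
    exact Subtype.ext hr
  have hs1 : 1 < (w s : ℝ) := by
    refine (one_lt_pow_iff_of_nonneg NNReal.zero_le_coe hp.ne_zero).mp ?_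
    rw [hs]
    exact_mod_cast hc
  have hsab : (w s : ℝ) < b / a := by
    refine lt_of_pow_lt_pow_left₀ p (by positivity) ?_
    rw [hs]
    exact hn.trans_le (pow_le_pow_right₀ hba.le (by lia))
  obtain ⟨i, hi⟩ := exists_zpow_mem_Ioo ha hs1 hsab
  exact ⟨s ^ i, by simpa using hi⟩
end

section
/- Let A be an integral domain of Krull dimension 2. Let a ∈ A be a nonzero element generating a prime ideal (a), and assume that m is the unique maximal ideal of A containing a. Then for every element t ∈ m with t ∉ (a), the radical of the ideal (a, t) equals m. -/
/-- In a ring of Krull dimension at most 2, a prime at the top of a chain of three primes is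
maximal. -/
theorem Ideal.IsPrime.isMaximal_of_lt_of_lt_of_ringKrullDim_le_two {R : Type*} [CommRing R]
    (hdim : ringKrullDim R ≤ 2) {p q r : Ideal R} (hp : p.IsPrime) (hq : q.IsPrime)
    (hr : r.IsPrime) (hpq : p < q) (hqr : q < r) : r.IsMaximal := by
  obtain ⟨M, hM, hrM⟩ := Ideal.exists_le_maximal r hr.ne_top
  rcases hrM.eq_or_lt with rfl | hlt
  · exact hM
  let s : LTSeries (PrimeSpectrum R) :=
    { length := 3
      toFun := ![⟨p, hp⟩, ⟨q, hq⟩, ⟨r, hr⟩, ⟨M, hM.isPrime⟩]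
      step := fun i ↦ by
        fin_cases i
        exacts [hpq, hqr, hlt] }
  have hs : ((3 : ℕ) : WithBot ℕ∞) ≤ ((2 : ℕ) : WithBot ℕ∞) :=
    (Order.LTSeries.length_le_krullDim s).trans hdim
  exact absurd (Nat.cast_le.mp hs) (by norm_num)

/-- Let `A` be an integral domain of Krull dimension 2, let
`a ∈ A` be a nonzero element generating a prime ideal `(a)`, and assume that `m`
is the unique maximal ideal of `A` containing `a`.  Then for every `t ∈ m` with
`t ∉ (a)`, the radical of the ideal `(a, t)` equals `m`. -/
theorem radical_span_pair_eq_maximal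
    (A : Type) [CommRing A] [IsDomain A]
    (hdim : ringKrullDim A = 2)
    (a : A) (ha : a ≠ 0) (haprime : (Ideal.span {a} : Ideal A).IsPrime)
    (m : Ideal A) (hmmax : m.IsMaximal) (ham : a ∈ m)
    (huniq : ∀ m' : Ideal A, m'.IsMaximal → a ∈ m' → m' = m) :
    ∀ t ∈ m, t ∉ (Ideal.span {a} : Ideal A) →
      (Ideal.span {a, t} : Ideal A).radical = m := by
  intro t htm hta
  refine le_antisymm ?_ ?_
  · rw [hmmax.isPrime.radical_le_iff, Ideal.span_le]
    exact Set.pair_subset ham htm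
  · rw [Ideal.radical_eq_sInf]
    refine le_sInf fun P ⟨hle, hP⟩ ↦ ?_
    have haP : a ∈ P := hle (Ideal.subset_span (by simp))
    have htP : t ∈ P := hle (Ideal.subset_span (by simp))
    have hbot : (⊥ : Ideal A) < Ideal.span {a} := by
      rwa [bot_lt_iff_ne_bot, Ne, Ideal.span_singleton_eq_bot]
    have hlt : Ideal.span {a} < P :=
      lt_of_le_of_ne ((Ideal.span_singleton_le_iff_mem P).mpr haP) fun h ↦ hta (h ▸ htP)
    exact (huniq P (Ideal.isPrime_bot.isMaximal_of_lt_of_lt_of_ringKrullDim_le_two hdim.le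
      haprime hP hbot hlt) haP).ge
end

section
/- Let C be a connected, locally connected T1 topological space, let S be a finite nonempty subset of C, and for each s ∈ S let U_s be an open neighborhood of s whose topological frontier is a finite set. Then only finitely many connected components of C ∖ S are not contained in the union ⋃_{s∈S} U_s. -/
/-- In a connected, locally connected space, the closure of a connected component of a proper open
subset meets the complement of that subset. -/
theorem IsOpen.closure_connectedComponentIn_inter_compl_nonempty {X : Type*} [TopologicalSpace X]
    [PreconnectedSpace X] [LocallyConnectedSpace X] {V : Set X} (hV : IsOpen V)
    (hne : Vᶜ.Nonempty) {x : X} (hx : x ∈ V) :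
    (closure (connectedComponentIn V x) ∩ Vᶜ).Nonempty := by
  by_contra h
  have hsub : closure (connectedComponentIn V x) ⊆ V := fun y hy => by
    by_contra hyV
    exact h ⟨y, hy, hyV⟩
  have hclosed : IsClosed (connectedComponentIn V x) :=
    isClosed_of_closure_subset <|
      isPreconnected_connectedComponentIn.closure.subset_connectedComponentIn
        (subset_closure (mem_connectedComponentIn hx)) hsub
  have huniv : connectedComponentIn V x = Set.univ :=
    IsClopen.eq_univ ⟨hclosed, hV.connectedComponentIn⟩ ⟨x, mem_connectedComponentIn hx⟩
  obtain ⟨s, hs⟩ := hne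
  exact hs (connectedComponentIn_subset V x (huniv ▸ Set.mem_univ s))

/-- A preconnected set meeting both an open set and its complement meets the frontier. -/
theorem IsPreconnected.inter_frontier_nonempty_of_isOpen {X : Type*} [TopologicalSpace X]
    {T U : Set X} (hT : IsPreconnected T) (hU : IsOpen U) (h : (T ∩ U).Nonempty)
    (h' : (T ∩ Uᶜ).Nonempty) : (T ∩ frontier U).Nonempty := by
  rw [hU.frontier_eq]
  by_contra hempty
  have hcl : T ∩ closure U ⊆ U := fun z hz => by
    by_contra hzU
    exact hempty ⟨z, hz.1, hz.2, hzU⟩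
  obtain ⟨y, hyT, hyU⟩ := h'
  obtain ⟨z, -, hzU, hz⟩ := hT U (closure U)ᶜ hU isClosed_closure.isOpen_compl
    (fun z hz => (em (z ∈ closure U)).imp (fun hzc => hcl ⟨hz, hzc⟩) id) h
    ⟨y, hyT, fun hyc => hyU (hcl ⟨hyT, hyc⟩)⟩
  exact hz (subset_closure hzU)

/-- Let `C` be a connected, locally connected T1 space, `S` a
finite nonempty subset of `C`, and for each `s ∈ S` let `U s` be an open
neighborhood of `s` with finite frontier.  Then only finitely many connected
components of `C \ S` are not contained in `⋃ s ∈ S, U s`. -/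
theorem finitely_many_components_not_covered
    (C : Type) [TopologicalSpace C] [ConnectedSpace C]
    [LocallyConnectedSpace C] [T1Space C]
    (S : Set C) (hSfin : S.Finite) (hSne : S.Nonempty)
    (U : C → Set C)
    (hUopen : ∀ s ∈ S, IsOpen (U s)) (hUmem : ∀ s ∈ S, s ∈ U s)
    (hUfr : ∀ s ∈ S, (frontier (U s)).Finite) :
    {T : Set C | (∃ x ∈ Sᶜ, T = connectedComponentIn Sᶜ x) ∧
        ¬ T ⊆ ⋃ s ∈ S, U s}.Finite := by
  refine ((hSfin.biUnion hUfr).image (connectedComponentIn Sᶜ)).subset ?_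
  rintro T ⟨⟨x, hx, rfl⟩, hT⟩
  obtain ⟨s, hsT, hs⟩ :=
    hSfin.isClosed.isOpen_compl.closure_connectedComponentIn_inter_compl_nonempty
      (by rwa [compl_compl]) hx
  rw [compl_compl] at hs
  have hmeet : (connectedComponentIn Sᶜ x ∩ U s).Nonempty := by
    rw [Set.inter_comm]
    exact mem_closure_iff.1 hsT _ (hUopen s hs) (hUmem s hs)
  have hnot : (connectedComponentIn Sᶜ x ∩ (U s)ᶜ).Nonempty := by
    rw [Set.inter_compl_nonempty_iff]
    exact fun h => hT (h.trans (Set.subset_biUnion_of_mem hs))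
  obtain ⟨z, hzT, hz⟩ :=
    isPreconnected_connectedComponentIn.inter_frontier_nonempty_of_isOpen (hUopen s hs) hmeet hnot
  exact ⟨z, Set.mem_biUnion hs hz, (connectedComponentIn_eq hzT).symm⟩
end

section
/- Let p be an odd prime number. The quadratic form X₁² − (1 + pT)X₂² + T·X₃² − (T + p)·X₄² is isotropic over the field ℚ_p(T) of rational functions over the p-adic numbers: there exist rational functions x₁, x₂, x₃, x₄ ∈ ℚ_p(T), not all zero, such that x₁² − (1 + pT)·x₂² + T·x₃² − (T + p)·x₄² = 0. -/
theorem PadicInt.exists_sq_eq_one_add_prime (p : ℕ) [Fact p.Prime] (hp : Odd p) :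
    ∃ s : ℤ_[p], s ^ 2 = 1 + p := by
  have h2 : ‖(2 : ℤ_[p])‖ = 1 := by
    have h := PadicInt.norm_natCast_eq_one_iff (p := p) (n := 2)
    rw [Nat.cast_ofNat] at h
    exact h.2 hp.coprime_two_right
  obtain ⟨s, hs, -⟩ := hensels_lemma (p := p) (R := ℤ_[p])
    (F := Polynomial.X ^ 2 - Polynomial.C (1 + (p : ℤ_[p]))) (a := 1) (by
      simpa [h2, one_add_one_eq_two] using inv_lt_one_of_one_lt₀ (Nat.one_lt_cast (α := ℝ).2 (Fact.out : p.Prime).one_lt))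
  exact ⟨s, by simpa [sub_eq_zero] using hs⟩

/-- Let `p` be an odd prime.  The quadratic form
`X₁² − (1 + pT)X₂² + T·X₃² − (T + p)·X₄²` is isotropic over `ℚ_p(T)`:
there are rational functions `x₁, x₂, x₃, x₄`, not all zero, with
`x₁² − (1 + pT)x₂² + T x₃² − (T + p) x₄² = 0`. -/
theorem isotropic_example_over_Qp_T
    (p : ℕ) [Fact p.Prime] (hp : Odd p) :
    ∃ x₁ x₂ x₃ x₄ : RatFunc ℚ_[p],
      ¬ (x₁ = 0 ∧ x₂ = 0 ∧ x₃ = 0 ∧ x₄ = 0) ∧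
      x₁ ^ 2 - (1 + RatFunc.C (p : ℚ_[p]) * RatFunc.X) * x₂ ^ 2
        + RatFunc.X * x₃ ^ 2
        - (RatFunc.X + RatFunc.C (p : ℚ_[p])) * x₄ ^ 2 = 0 := by
  obtain ⟨s, hs⟩ := PadicInt.exists_sq_eq_one_add_prime p hp
  have hC : RatFunc.C (s : ℚ_[p]) ^ 2 = 1 + RatFunc.C (p : ℚ_[p]) := by
    have h : (s : ℚ_[p]) ^ 2 = 1 + p := by exact_mod_cast congrArg ((↑) : ℤ_[p] → ℚ_[p]) hs
    rw [← map_pow, h, map_add, map_one]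
  refine ⟨RatFunc.C (s : ℚ_[p]), 1, RatFunc.C (s : ℚ_[p]), 1, fun h => one_ne_zero h.2.1, ?_⟩
  linear_combination (1 + RatFunc.X) * hC
end
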